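/- Let m ≥ 1 and N > 2m be integers, let Ψ satisfy condition (K), and let p ≥ 1, q > 0. If u ∈ C^{2m}(ℝ^N) is a non-negative solution of −(−Δ)^m u ≥ (Ψ(|·|) * u^p) u^q in ℝ^N, then u ≡ 0. -/

import Mathlib

open MeasureTheory Filter Metric

/-- The Laplacian of `u : ℝ^N → ℝ`, defined via the second iterated Fréchet derivative. -/
noncomputable def lap {N : ℕ} (u : EuclideanSpace ℝ (Fin N) → ℝ) :
    EuclideanSpace ℝ (Fin N) → ℝ :=
  fun x => ∑ i : Fin N,
    iteratedFDeriv ℝ 2 u x ![EuclideanSpace.single i 1, EuclideanSpace.single i 1]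

/-- `negLapPow m u = (-Δ)^m u`, the `m`-fold iterate of the negative Laplacian. -/
noncomputable def negLapPow {N : ℕ} (m : ℕ) (u : EuclideanSpace ℝ (Fin N) → ℝ) :
    EuclideanSpace ℝ (Fin N) → ℝ :=
  (fun v => fun x => -(lap v x))^[m] u

/-- Condition (K) on the kernel `Ψ`. -/
structure CondK (N : ℕ) (Ψ : ℝ → ℝ) : Prop where
  pos : ∀ r : ℝ, 0 < r → 0 < Ψ r
  cont : ContinuousOn (fun x : EuclideanSpace ℝ (Fin N) => Ψ ‖x‖)
    {(0 : EuclideanSpace ℝ (Fin N))}ᶜ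
  locInt : LocallyIntegrable (fun x : EuclideanSpace ℝ (Fin N) => Ψ ‖x‖) volume
  anti : AntitoneOn Ψ (Set.Ioi (0 : ℝ))
  tendsto : Tendsto (fun r : ℝ => r ^ N * Ψ r) atTop atTop

theorem lap_eq_sum_fderiv {N : ℕ} {v : EuclideanSpace ℝ (Fin N) → ℝ} (hv : ContDiff ℝ 2 v)
    (x : EuclideanSpace ℝ (Fin N)) :
    lap v x = ∑ i : Fin N, fderiv ℝ (fun y => fderiv ℝ v y (EuclideanSpace.single i 1)) x
      (EuclideanSpace.single i 1) := by
  have hd : Differentiable ℝ (fderiv ℝ v) :=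
    (hv.fderiv_right (m := 1) (by norm_num)).differentiable (by norm_num)
  refine Finset.sum_congr rfl fun i _ => ?_
  rw [iteratedFDeriv_two_apply, fderiv_clm_apply (hd x) (differentiableAt_const _)]
  simp

theorem contDiff_fderiv_apply_const {E : Type*} [NormedAddCommGroup E] [NormedSpace ℝ E]
    {v : E → ℝ} {k : ℕ} (hv : ContDiff ℝ (k + 1 : ℕ) v) (e : E) :
    ContDiff ℝ k (fun y => fderiv ℝ v y e) :=
  (hv.fderiv_right (m := k) (by norm_cast)).clm_apply contDiff_const

theorem contDiff_lap {N k : ℕ} {v : EuclideanSpace ℝ (Fin N) → ℝ}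
    (hv : ContDiff ℝ (k + 2 : ℕ) v) : ContDiff ℝ k (lap v) := by
  have h2 : ContDiff ℝ 2 v := hv.of_le (by norm_cast; omega)
  rw [show lap v = _ from funext (lap_eq_sum_fderiv h2)]
  exact ContDiff.sum fun i _ => contDiff_fderiv_apply_const (contDiff_fderiv_apply_const hv _) _

theorem negLapPow_succ {N : ℕ} (k : ℕ) (v : EuclideanSpace ℝ (Fin N) → ℝ) :
    negLapPow (k + 1) v = fun x => -(lap (negLapPow k v) x) :=
  Function.iterate_succ_apply' _ _ _

theorem negLapPow_succ' {N : ℕ} (k : ℕ) (v : EuclideanSpace ℝ (Fin N) → ℝ) :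
    negLapPow (k + 1) v = negLapPow k fun x => -(lap v x) :=
  Function.iterate_succ_apply _ _ _

theorem contDiff_negLapPow {N k l : ℕ} {v : EuclideanSpace ℝ (Fin N) → ℝ}
    (hv : ContDiff ℝ (l + 2 * k : ℕ) v) : ContDiff ℝ l (negLapPow k v) := by
  induction k generalizing v with
  | zero => exact hv
  | succ k ih =>
    rw [negLapPow_succ']
    exact ih (contDiff_lap hv).neg

theorem tsupport_lap_subset {N : ℕ} (φ : EuclideanSpace ℝ (Fin N) → ℝ) :
    tsupport (lap φ) ⊆ tsupport φ := by
  refine Set.Subset.trans ?_ (tsupport_iteratedFDeriv_subset (𝕜 := ℝ) 2)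
  exact closure_mono fun x hx h => hx (by simp [lap, h])

theorem hasCompactSupport_lap {N : ℕ} {φ : EuclideanSpace ℝ (Fin N) → ℝ}
    (hφ : HasCompactSupport φ) : HasCompactSupport (lap φ) :=
  hφ.mono' (subset_closure.trans (tsupport_lap_subset φ))

/-- Integration by parts against a compactly supported function. -/
theorem integral_mul_fderiv_of_hasCompactSupport {N : ℕ} {f g : EuclideanSpace ℝ (Fin N) → ℝ}
    (hf : ContDiff ℝ 1 f) (hg : ContDiff ℝ 1 g) (hc : HasCompactSupport g)
    (e : EuclideanSpace ℝ (Fin N)) :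
    ∫ y, f y * fderiv ℝ g y e = -∫ y, fderiv ℝ f y e * g y := by
  have hf' : Continuous fun y => fderiv ℝ f y e :=
    (hf.continuous_fderiv one_ne_zero).clm_apply continuous_const
  have hg' : Continuous fun y => fderiv ℝ g y e :=
    (hg.continuous_fderiv one_ne_zero).clm_apply continuous_const
  refine integral_mul_fderiv_eq_neg_fderiv_mul_of_integrable ?_ ?_ ?_
    (fun x _ => hf.differentiable one_ne_zero x) (fun x _ => hg.differentiable one_ne_zero x)
  · exact (hf'.mul hg.continuous).integrable_of_hasCompactSupport hc.mul_left
  · exact (hf.continuous.mul hg').integrable_of_hasCompactSupport (hc.fderiv_apply ℝ e).mul_left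
  · exact (hf.continuous.mul hg.continuous).integrable_of_hasCompactSupport hc.mul_left

/-- Green's identity against a compactly supported function. -/
theorem integral_lap_mul {N : ℕ} {v φ : EuclideanSpace ℝ (Fin N) → ℝ}
    (hv : ContDiff ℝ 2 v) (hφ : ContDiff ℝ 2 φ) (hc : HasCompactSupport φ) :
    ∫ y, lap v y * φ y = ∫ y, v y * lap φ y := by
  have hv1 : ContDiff ℝ 1 v := hv.of_le (by norm_num)
  have hφ1 : ContDiff ℝ 1 φ := hφ.of_le (by norm_num)
  have hdv (i : Fin N) : ContDiff ℝ 1 fun y => fderiv ℝ v y (EuclideanSpace.single i 1) :=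
    contDiff_fderiv_apply_const (k := 1) hv _
  have hdφ (i : Fin N) : ContDiff ℝ 1 fun y => fderiv ℝ φ y (EuclideanSpace.single i 1) :=
    contDiff_fderiv_apply_const (k := 1) hφ _
  have hcd (i : Fin N) : HasCompactSupport fun y => fderiv ℝ φ y (EuclideanSpace.single i 1) :=
    hc.fderiv_apply ℝ _
  have hdd {w : EuclideanSpace ℝ (Fin N) → ℝ} (hw : ContDiff ℝ 1 w)
      (e : EuclideanSpace ℝ (Fin N)) : Continuous fun y => fderiv ℝ w y e :=
    (hw.continuous_fderiv one_ne_zero).clm_apply continuous_const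
  simp only [lap_eq_sum_fderiv hv, lap_eq_sum_fderiv hφ, Finset.sum_mul, Finset.mul_sum]
  rw [integral_finsetSum, integral_finsetSum]
  · refine Finset.sum_congr rfl fun i _ => ?_
    rw [integral_mul_fderiv_of_hasCompactSupport hv1 (hdφ i) (hcd i),
      integral_mul_fderiv_of_hasCompactSupport (hdv i) hφ1 hc, neg_neg]
  · exact fun i _ => (hv.continuous.mul (hdd (hdφ i) _)).integrable_of_hasCompactSupport
      ((hcd i).fderiv_apply ℝ _).mul_left
  · exact fun i _ => ((hdd (hdv i) _).mul hφ.continuous).integrable_of_hasCompactSupport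
      hc.mul_left

theorem integral_negLapPow_mul {N k : ℕ} {v φ : EuclideanSpace ℝ (Fin N) → ℝ}
    (hv : ContDiff ℝ (2 * k : ℕ) v) (hφ : ∀ l : ℕ, ContDiff ℝ l φ)
    (hc : HasCompactSupport φ) :
    ∫ y, negLapPow k v y * φ y = ∫ y, v y * negLapPow k φ y := by
  induction k generalizing φ with
  | zero => rfl
  | succ k ih =>
    have hv2 : ContDiff ℝ 2 (negLapPow k v) :=
      contDiff_negLapPow (l := 2) (hv.of_le (by norm_cast; omega))
    rw [negLapPow_succ, negLapPow_succ',
      ← ih (hv.of_le (by norm_cast; omega)) (fun l => (contDiff_lap (hφ (l + 2))).neg)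
        (hasCompactSupport_lap hc).neg]
    simp only [neg_mul, mul_neg, integral_neg, integral_lap_mul hv2 (hφ 2) hc]

theorem tsupport_negLapPow_subset {N : ℕ} (φ : EuclideanSpace ℝ (Fin N) → ℝ) (k : ℕ) :
    tsupport (negLapPow k φ) ⊆ tsupport φ := by
  induction k with
  | zero => exact subset_rfl
  | succ k ih =>
    rw [negLapPow_succ]
    refine Set.Subset.trans ?_ ((tsupport_lap_subset _).trans ih)
    exact closure_mono fun x hx h => hx (by simp [h])

theorem fderiv_comp_add_smul {E : Type*} [NormedAddCommGroup E] [NormedSpace ℝ E]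
    (v : E → ℝ) (x : E) (R : ℝ) (y : E) :
    fderiv ℝ (fun y => v (x + R • y)) y = R • fderiv ℝ v (x + R • y) := by
  rw [fderiv_comp_smul (f := fun z => v (x + z)), fderiv_comp_add_left]

theorem lap_comp_add_smul {N : ℕ} {v : EuclideanSpace ℝ (Fin N) → ℝ} (hv : ContDiff ℝ 2 v)
    (x : EuclideanSpace ℝ (Fin N)) (R : ℝ) :
    lap (fun y => v (x + R • y)) = fun y => R ^ 2 * lap v (x + R • y) := by
  have h : ContDiff ℝ 2 fun y => v (x + R • y) := hv.comp (by fun_prop)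
  funext y
  rw [lap_eq_sum_fderiv h, lap_eq_sum_fderiv hv, Finset.mul_sum]
  refine Finset.sum_congr rfl fun i _ => ?_
  have hd : ContDiff ℝ 1 fun y => fderiv ℝ v y (EuclideanSpace.single i 1) :=
    contDiff_fderiv_apply_const (k := 1) hv _
  have hdc : DifferentiableAt ℝ
      (fun y => fderiv ℝ v (x + R • y) (EuclideanSpace.single i 1)) y :=
    (hd.comp (by fun_prop : ContDiff ℝ 1
      fun y : EuclideanSpace ℝ (Fin N) => x + R • y)).differentiable one_ne_zero y
  simp only [fderiv_comp_add_smul, smul_apply]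
  rw [fderiv_fun_const_smul hdc,
    fderiv_comp_add_smul (fun y => fderiv ℝ v y (EuclideanSpace.single i 1))]
  simp only [smul_apply, smul_eq_mul]
  ring

theorem lap_const_mul {N : ℕ} {v : EuclideanSpace ℝ (Fin N) → ℝ} (hv : ContDiff ℝ 2 v) (c : ℝ) :
    lap (fun y => c * v y) = fun y => c * lap v y := by
  funext y
  simp only [lap, Finset.mul_sum]
  refine Finset.sum_congr rfl fun i _ => ?_
  simp only [← smul_eq_mul]
  rw [iteratedFDeriv_const_smul_apply' hv.contDiffAt]
  simp

theorem negLapPow_comp_add_smul {N k : ℕ} {v : EuclideanSpace ℝ (Fin N) → ℝ}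
    (hv : ContDiff ℝ (2 * k : ℕ) v) (x : EuclideanSpace ℝ (Fin N)) (R : ℝ) :
    negLapPow k (fun y => v (x + R • y)) =
      fun y => R ^ (2 * k) * negLapPow k v (x + R • y) := by
  induction k with
  | zero => funext y; simp [negLapPow]
  | succ k ih =>
    have hv2 : ContDiff ℝ 2 (negLapPow k v) :=
      contDiff_negLapPow (l := 2) (hv.of_le (by norm_cast; omega))
    have h : ContDiff ℝ 2 fun y => negLapPow k v (x + R • y) := hv2.comp (by fun_prop)
    rw [negLapPow_succ, ih (hv.of_le (by norm_cast; omega)), lap_const_mul h,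
      lap_comp_add_smul hv2, negLapPow_succ]
    funext y
    ring

/-- A smooth radial bump supported in the closed unit ball. -/
noncomputable def radialBump (N : ℕ) (y : EuclideanSpace ℝ (Fin N)) : ℝ :=
  expNegInvGlue (1 - ‖y‖ ^ 2)

/-- The smooth radial weight `φ` with `∇ (radialBump N) = -φ(y) y`. -/
noncomputable def radialWeight (N : ℕ) (y : EuclideanSpace ℝ (Fin N)) : ℝ :=
  2 * ((1 - ‖y‖ ^ 2)⁻¹ ^ 2 * expNegInvGlue (1 - ‖y‖ ^ 2))

theorem contDiff_radialBump (N n : ℕ) : ContDiff ℝ n (radialBump N) :=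
  (expNegInvGlue.contDiff (n := n)).comp (contDiff_const.sub (contDiff_norm_sq ℝ))

theorem contDiff_radialWeight (N n : ℕ) : ContDiff ℝ n (radialWeight N) := by
  have h := (expNegInvGlue.contDiff_polynomial_eval_inv_mul (n := n) (Polynomial.X ^ 2)).comp
    (contDiff_const (c := (1 : ℝ)).sub
      (contDiff_norm_sq (E := EuclideanSpace ℝ (Fin N)) ℝ))
  convert! contDiff_const (c := (2 : ℝ)).mul h using 1
  funext y
  simp [radialWeight]

theorem radialBump_eq_zero {N : ℕ} {y : EuclideanSpace ℝ (Fin N)} (hy : 1 ≤ ‖y‖) :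
    radialBump N y = 0 :=
  expNegInvGlue.zero_of_nonpos (by nlinarith)

theorem radialWeight_eq_zero {N : ℕ} {y : EuclideanSpace ℝ (Fin N)} (hy : 1 ≤ ‖y‖) :
    radialWeight N y = 0 := by
  rw [radialWeight, expNegInvGlue.zero_of_nonpos (by nlinarith)]
  simp

theorem hasCompactSupport_of_eq_zero_of_one_le_norm {N : ℕ} {φ : EuclideanSpace ℝ (Fin N) → ℝ}
    (h : ∀ y, 1 ≤ ‖y‖ → φ y = 0) : HasCompactSupport φ :=
  HasCompactSupport.intro (isCompact_closedBall 0 1) fun y hy =>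
    h y (by rw [mem_closedBall_zero_iff, not_le] at hy; exact hy.le)

theorem hasCompactSupport_radialBump (N : ℕ) : HasCompactSupport (radialBump N) :=
  hasCompactSupport_of_eq_zero_of_one_le_norm fun _ => radialBump_eq_zero

theorem hasCompactSupport_radialWeight (N : ℕ) : HasCompactSupport (radialWeight N) :=
  hasCompactSupport_of_eq_zero_of_one_le_norm fun _ => radialWeight_eq_zero

theorem radialWeight_nonneg {N : ℕ} (y : EuclideanSpace ℝ (Fin N)) : 0 ≤ radialWeight N y :=
  mul_nonneg zero_le_two (mul_nonneg (sq_nonneg _) (expNegInvGlue.nonneg _))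

theorem integral_radialWeight_pos (N : ℕ) : 0 < ∫ y, radialWeight N y := by
  have hc := (contDiff_radialWeight N 0).continuous
  refine hc.integral_pos_of_hasCompactSupport_nonneg_nonzero (hasCompactSupport_radialWeight N)
    radialWeight_nonneg (x := 0) ?_
  have := expNegInvGlue.pos_of_pos one_pos
  simp [radialWeight, this.ne']

theorem fderiv_radialBump_single {N : ℕ} (y : EuclideanSpace ℝ (Fin N)) (i : Fin N) :
    fderiv ℝ (radialBump N) y (EuclideanSpace.single i 1) = -(radialWeight N y * y i) := by
  have h1 := expNegInvGlue.hasDerivAt_polynomial_eval_inv_mul 1 (1 - ‖y‖ ^ 2)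
  simp only [Polynomial.eval_one, one_mul, Polynomial.derivative_one, sub_zero, mul_one,
    Polynomial.eval_pow, Polynomial.eval_X] at h1
  have h2 : HasFDerivAt (fun y : EuclideanSpace ℝ (Fin N) => 1 - ‖y‖ ^ 2)
      (-(2 • innerSL ℝ y)) y :=
    ((hasStrictFDerivAt_norm_sq y).hasFDerivAt).const_sub 1
  have h3 : HasFDerivAt (radialBump N) _ y := h1.comp_hasFDerivAt y h2
  rw [h3.fderiv]
  simp [radialWeight, EuclideanSpace.inner_single_right]
  ring

theorem apply_eq_sum_single {N : ℕ} (L : EuclideanSpace ℝ (Fin N) →L[ℝ] ℝ)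
    (y : EuclideanSpace ℝ (Fin N)) :
    L y = ∑ i, y i * L (EuclideanSpace.single i 1) := by
  conv_lhs => rw [← (EuclideanSpace.basisFun (Fin N) ℝ).sum_repr y]
  simp

/-- The derivative of the radial weighted average of `w` with respect to the radius. -/
theorem hasDerivAt_integral_comp_add_smul_mul_radialWeight {N : ℕ}
    {w : EuclideanSpace ℝ (Fin N) → ℝ} (hw : ContDiff ℝ 2 w)
    (x : EuclideanSpace ℝ (Fin N)) (R : ℝ) :
    HasDerivAt (fun R : ℝ => ∫ y, w (x + R • y) * radialWeight N y)
      (R * ∫ y, lap w (x + R • y) * radialBump N y) R := by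
  have hφ : Continuous (radialWeight N) := (contDiff_radialWeight N 0).continuous
  have hφc := hasCompactSupport_radialWeight N
  have hΦ : ContDiff ℝ 1 (radialBump N) := contDiff_radialBump N 1
  have hΦc := hasCompactSupport_radialBump N
  have hw' : Continuous (fderiv ℝ w) := hw.continuous_fderiv two_ne_zero
  have hdw (i : Fin N) : ContDiff ℝ 1 fun y => fderiv ℝ w y (EuclideanSpace.single i 1) :=
    contDiff_fderiv_apply_const (k := 1) hw _
  have hG : Continuous fun z : ℝ × EuclideanSpace ℝ (Fin N) =>
      fderiv ℝ w (x + z.1 • z.2) z.2 * radialWeight N z.2 := by fun_prop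
  have hGR (R : ℝ) : Continuous fun y : EuclideanSpace ℝ (Fin N) =>
      fderiv ℝ w (x + R • y) y * radialWeight N y := by fun_prop
  have hF (R : ℝ) : Continuous fun y : EuclideanSpace ℝ (Fin N) =>
      w (x + R • y) * radialWeight N y := by
    have := hw.continuous
    fun_prop
  obtain ⟨C, hC⟩ := ((isCompact_closedBall R 1).prod
    (isCompact_closedBall (0 : EuclideanSpace ℝ (Fin N)) 1)).exists_bound_of_continuousOn
      hG.continuousOn
  have key := (hasDerivAt_integral_of_dominated_loc_of_deriv_le (μ := volume)
    (F := fun (R : ℝ) (y : EuclideanSpace ℝ (Fin N)) => w (x + R • y) * radialWeight N y)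
    (F' := fun R y => fderiv ℝ w (x + R • y) y * radialWeight N y) (x₀ := R)
    (bound := (closedBall (0 : EuclideanSpace ℝ (Fin N)) 1).indicator fun _ => C)
    (ball_mem_nhds R one_pos) (.of_forall fun R => (hF R).aestronglyMeasurable)
    ((hF R).integrable_of_hasCompactSupport hφc.mul_left)
    (hGR R).aestronglyMeasurable
    (.of_forall fun y r hr => ?_) ?_ (.of_forall fun y r _ => ?_)).2
  · convert! key using 1
    have hlap (y : EuclideanSpace ℝ (Fin N)) : R * (lap w (x + R • y) * radialBump N y) =
        ∑ i, fderiv ℝ (fun y => fderiv ℝ w (x + R • y) (EuclideanSpace.single i 1)) y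
          (EuclideanSpace.single i 1) * radialBump N y := by
      rw [lap_eq_sum_fderiv hw, Finset.sum_mul, Finset.mul_sum]
      refine Finset.sum_congr rfl fun i _ => ?_
      rw [fderiv_comp_add_smul (fun y => fderiv ℝ w y (EuclideanSpace.single i 1))]
      simp only [smul_apply, smul_eq_mul]
      ring
    have hgrad (y : EuclideanSpace ℝ (Fin N)) : fderiv ℝ w (x + R • y) y * radialWeight N y =
        ∑ i, -(fderiv ℝ w (x + R • y) (EuclideanSpace.single i 1) *
          fderiv ℝ (radialBump N) y (EuclideanSpace.single i 1)) := by
      rw [apply_eq_sum_single, Finset.sum_mul]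
      refine Finset.sum_congr rfl fun i _ => ?_
      rw [fderiv_radialBump_single]
      ring
    have hcomp (i : Fin N) :
        ContDiff ℝ 1 fun y => fderiv ℝ w (x + R • y) (EuclideanSpace.single i 1) :=
      (hdw i).comp (by fun_prop : ContDiff ℝ 1
        fun y : EuclideanSpace ℝ (Fin N) => x + R • y)
    have hcf {g : EuclideanSpace ℝ (Fin N) → ℝ} (hg : ContDiff ℝ 1 g)
        (e : EuclideanSpace ℝ (Fin N)) : Continuous fun y => fderiv ℝ g y e :=
      (hg.continuous_fderiv one_ne_zero).clm_apply continuous_const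
    rw [← integral_const_mul]
    simp only [hlap, hgrad]
    rw [integral_finsetSum, integral_finsetSum]
    · refine Finset.sum_congr rfl fun i _ => ?_
      rw [integral_neg, integral_mul_fderiv_of_hasCompactSupport (hcomp i) hΦ hΦc, neg_neg]
    · exact fun i _ => (((hcomp i).continuous.mul (hcf hΦ _)).integrable_of_hasCompactSupport
        (hΦc.fderiv_apply ℝ _).mul_left).neg
    · exact fun i _ => ((hcf (hcomp i) _).mul hΦ.continuous).integrable_of_hasCompactSupport
        hΦc.mul_left
  · by_cases hy : y ∈ closedBall (0 : EuclideanSpace ℝ (Fin N)) 1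
    · rw [Set.indicator_of_mem hy]
      exact hC (r, y) ⟨ball_subset_closedBall hr, hy⟩
    · rw [Set.indicator_of_notMem hy]
      rw [mem_closedBall_zero_iff, not_le] at hy
      simp [radialWeight_eq_zero hy.le]
  · exact (integrable_indicator_iff measurableSet_closedBall).2
      (integrableOn_const measure_closedBall_lt_top.ne)
  · have h1 : HasDerivAt (fun r : ℝ => x + r • y) y r := by
      simpa using ((hasDerivAt_id r).smul_const y).const_add x
    exact ((hw.differentiable two_ne_zero _).hasFDerivAt.comp_hasDerivAt r h1).mul_const _

/-- Mean value inequality for subharmonic functions, with a smooth radial weight. -/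
theorem mul_integral_radialWeight_le {N : ℕ} {w : EuclideanSpace ℝ (Fin N) → ℝ}
    (hw : ContDiff ℝ 2 w) (hsub : ∀ x, 0 ≤ lap w x) (x : EuclideanSpace ℝ (Fin N))
    {R : ℝ} (hR : 0 ≤ R) :
    w x * ∫ y, radialWeight N y ≤ ∫ y, w (x + R • y) * radialWeight N y := by
  have hd := hasDerivAt_integral_comp_add_smul_mul_radialWeight hw x
  have hmono : MonotoneOn (fun R : ℝ => ∫ y, w (x + R • y) * radialWeight N y) (Set.Ici 0) := by
    refine monotoneOn_of_deriv_nonneg (convex_Ici 0)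
      (fun r _ => (hd r).continuousAt.continuousWithinAt)
      (fun r _ => (hd r).differentiableAt.differentiableWithinAt) fun r hr => ?_
    rw [interior_Ici, Set.mem_Ioi] at hr
    rw [(hd r).deriv]
    exact mul_nonneg hr.le (integral_nonneg fun y =>
      mul_nonneg (hsub _) (expNegInvGlue.nonneg _))
  have := hmono Set.self_mem_Ici (Set.mem_Ici.2 hR) hR
  simpa [integral_const_mul] using this

/-- If `∫_{|y| > 1} f(y) Ψ(|y| / 2) dy` is finite and `r ^ N Ψ(r) → ∞`, then the averages of `f`
over large balls tend to zero. -/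
theorem CondK.tendsto_setIntegral_closedBall_zero {N : ℕ} (hN : N ≠ 0) {Ψ : ℝ → ℝ}
    (hK : CondK N Ψ) {f : EuclideanSpace ℝ (Fin N) → ℝ} (hf : Continuous f) (hf0 : ∀ x, 0 ≤ f x)
    (hint : IntegrableOn (fun y => f y * Ψ (‖y‖ / 2)) {y | 1 < ‖y‖})
    (x : EuclideanSpace ℝ (Fin N)) :
    Tendsto (fun R : ℝ => ∫ y in closedBall 0 1, f (x + R • y)) atTop (nhds 0) := by
  set I := ∫ y in {y : EuclideanSpace ℝ (Fin N) | 1 < ‖y‖}, f y * Ψ (‖y‖ / 2)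
  set K := ∫ y in closedBall (0 : EuclideanSpace ℝ (Fin N)) 1, f y
  have hloc (z : EuclideanSpace ℝ (Fin N)) (r : ℝ) : IntegrableOn f (closedBall z r) :=
    hf.continuousOn.integrableOn_compact (isCompact_closedBall z r)
  have hlim : Tendsto (fun R : ℝ => K * (R ^ N)⁻¹ + I * (R ^ N * Ψ R)⁻¹) atTop (nhds 0) := by
    simpa using ((tendsto_pow_atTop hN).inv_tendsto_atTop.const_mul K).add
      (hK.tendsto.inv_tendsto_atTop.const_mul I)
  refine squeeze_zero' (.of_forall fun R => integral_nonneg fun y => hf0 _) ?_ hlim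
  filter_upwards [eventually_ge_atTop 1, eventually_ge_atTop ‖x‖] with R hR1 hRx
  have hR : 0 < R := one_pos.trans_le hR1
  have hΨ : 0 < Ψ R := hK.pos R hR
  have hscale : ∫ y in closedBall 0 1, f (x + R • y) =
      (R ^ N)⁻¹ * ∫ y in closedBall x R, f y := by
    have h := Measure.setIntegral_comp_smul_of_pos volume (fun z => f (x + z))
      (closedBall (0 : EuclideanSpace ℝ (Fin N)) 1) hR
    rw [finrank_euclideanSpace_fin, smul_unitClosedBall_of_nonneg hR.le, smul_eq_mul] at h
    rw [h, ← (measurePreserving_add_left volume x).setIntegral_preimage_emb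
      (measurableEmbedding_addLeft x) f (closedBall x R)]
    simp
  have hsub : closedBall x R ⊆ closedBall 0 (2 * R) :=
    closedBall_subset_closedBall' (by rw [dist_zero_right]; linarith)
  have hfar : ∫ y in closedBall 0 (2 * R) \ closedBall 0 1, f y ≤ (Ψ R)⁻¹ * I := by
    have hss : closedBall (0 : EuclideanSpace ℝ (Fin N)) (2 * R) \ closedBall 0 1 ⊆
        {y | 1 < ‖y‖} := fun y hy => by simpa using hy.2
    calc ∫ y in closedBall 0 (2 * R) \ closedBall 0 1, f y
        ≤ ∫ y in closedBall 0 (2 * R) \ closedBall 0 1, (Ψ R)⁻¹ * (f y * Ψ (‖y‖ / 2)) := by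
          refine setIntegral_mono_on ((hloc 0 _).mono_set Set.sdiff_subset)
            ((hint.mono_set hss).const_mul _)
            (measurableSet_closedBall.diff measurableSet_closedBall) fun y hy => ?_
          have h1 : 1 < ‖y‖ := hss hy
          have h2 : ‖y‖ ≤ 2 * R := by simpa using hy.1
          have h3 : Ψ R ≤ Ψ (‖y‖ / 2) :=
            hK.anti (Set.mem_Ioi.2 (by linarith)) (Set.mem_Ioi.2 hR) (by linarith)
          calc f y = (Ψ R)⁻¹ * (f y * Ψ R) := by field_simp
            _ ≤ _ := by gcongr; exact hf0 y
      _ = (Ψ R)⁻¹ * ∫ y in closedBall 0 (2 * R) \ closedBall 0 1, f y * Ψ (‖y‖ / 2) :=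
          integral_const_mul _ _
      _ ≤ (Ψ R)⁻¹ * I := by
          gcongr
          refine setIntegral_mono_set hint ?_ hss.eventuallyLE
          refine (ae_restrict_iff' (measurableSet_lt measurable_const measurable_norm)).2
            (.of_forall fun y hy => mul_nonneg (hf0 y) (hK.pos _ ?_).le)
          rw [Set.mem_ofPred_eq] at hy
          linarith
  calc ∫ y in closedBall 0 1, f (x + R • y)
      = (R ^ N)⁻¹ * ∫ y in closedBall x R, f y := hscale
    _ ≤ (R ^ N)⁻¹ * ∫ y in closedBall 0 (2 * R), f y := by
        gcongr
        · exact .of_forall hf0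
        · exact hloc _ _
    _ = (R ^ N)⁻¹ * ((∫ y in closedBall 0 (2 * R) \ closedBall 0 1, f y) + K) := by
        rw [setIntegral_sdiff measurableSet_closedBall (hloc _ _)
          (closedBall_subset_closedBall (by linarith)), sub_add_cancel]
    _ ≤ (R ^ N)⁻¹ * ((Ψ R)⁻¹ * I + K) := by gcongr
    _ = K * (R ^ N)⁻¹ + I * (R ^ N * Ψ R)⁻¹ := by rw [mul_inv]; ring

/-- Vanishing of the averages of `u ^ p` with `p ≥ 1` implies vanishing of the averages of `u`. -/
theorem tendsto_setIntegral_zero_of_rpow {α ι : Type*} [MeasurableSpace α] {μ : Measure α}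
    {l : Filter ι} {s : Set α} (hs : MeasurableSet s) (hμ : μ s ≠ ⊤) {p : ℝ} (hp : 1 ≤ p)
    {f : ι → α → ℝ} (hf0 : ∀ i y, 0 ≤ f i y) (hf : ∀ i, IntegrableOn (f i) s μ)
    (hfp : ∀ i, IntegrableOn (fun y => f i y ^ p) s μ)
    (h : Tendsto (fun i => ∫ y in s, f i y ^ p ∂μ) l (nhds 0)) :
    Tendsto (fun i => ∫ y in s, f i y ∂μ) l (nhds 0) := by
  rw [Metric.tendsto_nhds]
  intro δ hδ
  set V := μ.real s
  have hV : 0 ≤ V := measureReal_nonneg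
  set ε := δ / (2 * (V + 1)) with hεdef
  have hε : 0 < ε := by positivity
  have hεV : ε * V < δ / 2 := by
    have : ε * (V + 1) = δ / 2 := by rw [hεdef]; field_simp
    nlinarith
  have hlim : Tendsto (fun i => ε ^ (1 - p) * ∫ y in s, f i y ^ p ∂μ) l (nhds 0) := by
    simpa using h.const_mul (ε ^ (1 - p))
  filter_upwards [hlim.eventually_lt_const (half_pos hδ)] with i hi
  have hpt (y : α) : f i y ≤ ε + ε ^ (1 - p) * f i y ^ p := by
    have hnn : 0 ≤ ε ^ (1 - p) * f i y ^ p :=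
      mul_nonneg (Real.rpow_nonneg hε.le _) (Real.rpow_nonneg (hf0 i y) _)
    rcases le_total (f i y) ε with hle | hle
    · linarith
    · have h1 : f i y / ε ≤ (f i y / ε) ^ p :=
        Real.self_le_rpow_of_one_le ((one_le_div hε).2 hle) hp
      have h2 : ε * (f i y / ε) ^ p = ε ^ (1 - p) * f i y ^ p := by
        rw [Real.div_rpow (hf0 i y) hε.le, Real.rpow_sub hε, Real.rpow_one]
        ring
      have h3 : f i y = ε * (f i y / ε) := by field_simp
      have h4 := mul_le_mul_of_nonneg_left h1 hε.le
      linarith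
  have hbound : ∫ y in s, f i y ∂μ ≤ ε * V + ε ^ (1 - p) * ∫ y in s, f i y ^ p ∂μ := by
    calc ∫ y in s, f i y ∂μ ≤ ∫ y in s, (ε + ε ^ (1 - p) * f i y ^ p) ∂μ :=
          setIntegral_mono_on (hf i) ((integrableOn_const hμ).add ((hfp i).const_mul _)) hs
            fun y _ => hpt y
      _ = ε * V + ε ^ (1 - p) * ∫ y in s, f i y ^ p ∂μ := by
          rw [integral_add (integrableOn_const hμ).integrable ((hfp i).const_mul _), integral_const_mul,
            setIntegral_const, smul_eq_mul, mul_comm]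
  rw [Real.dist_0_eq_abs, abs_of_nonneg (integral_nonneg fun y => hf0 i y)]
  linarith

/-- Liouville-type descent: if the averages of `u ≥ 0` over large balls vanish, then
`(-Δ)^{k+1} u ≤ 0` implies `(-Δ)^k u ≤ 0`. -/
theorem negLapPow_nonpos_of_succ {N k : ℕ} {u : EuclideanSpace ℝ (Fin N) → ℝ}
    (hu : ContDiff ℝ (2 * (k + 1) : ℕ) u) (hu0 : ∀ x, 0 ≤ u x)
    (havg : ∀ x, Tendsto (fun R : ℝ => ∫ y in closedBall 0 1, u (x + R • y)) atTop (nhds 0))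
    (h : ∀ x, negLapPow (k + 1) u x ≤ 0) (x : EuclideanSpace ℝ (Fin N)) :
    negLapPow k u x ≤ 0 := by
  have huk : ContDiff ℝ (2 * k : ℕ) u := hu.of_le (by norm_cast; omega)
  have hw : ContDiff ℝ 2 (negLapPow k u) :=
    contDiff_negLapPow (l := 2) (hu.of_le (by norm_cast; omega))
  have hsub (x : EuclideanSpace ℝ (Fin N)) : 0 ≤ lap (negLapPow k u) x := by
    have := h x
    rw [negLapPow_succ] at this
    linarith
  have hg : Continuous (negLapPow k (radialWeight N)) :=
    (contDiff_negLapPow (l := 0) (contDiff_radialWeight N _)).continuous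
  obtain ⟨C, hC⟩ := (isCompact_closedBall
    (0 : EuclideanSpace ℝ (Fin N)) 1).exists_bound_of_continuousOn hg.continuousOn
  have hsupp (y : EuclideanSpace ℝ (Fin N)) (hy : y ∉ closedBall 0 1) :
      negLapPow k (radialWeight N) y = 0 := by
    refine image_eq_zero_of_notMem_tsupport fun hy' => hy ?_
    refine closure_minimal (fun z hz => ?_) isClosed_closedBall (tsupport_negLapPow_subset _ _ hy')
    rw [mem_closedBall_zero_iff]
    by_contra! hlt
    exact hz (radialWeight_eq_zero hlt.le)
  refine nonpos_of_mul_nonpos_left ?_ (integral_radialWeight_pos N)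
  have hlim : Tendsto (fun R : ℝ => C * ∫ y in closedBall 0 1, u (x + R • y)) atTop (nhds 0) := by
    simpa using (havg x).const_mul C
  refine ge_of_tendsto hlim ?_
  filter_upwards [eventually_ge_atTop 1] with R hR
  have hR0 : 0 < R := one_pos.trans_le hR
  have hRk : 1 ≤ R ^ (2 * k) := one_le_pow₀ hR
  have huR : ContDiff ℝ (2 * k : ℕ) fun y => u (x + R • y) := huk.comp (by fun_prop)
  have huRint : IntegrableOn (fun y => u (x + R • y)) (closedBall 0 1) :=
    huR.continuous.continuousOn.integrableOn_compact (isCompact_closedBall _ _)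
  have hC0 : 0 ≤ C := (norm_nonneg _).trans (hC 0 (mem_closedBall_self zero_le_one))
  have hJ : 0 ≤ ∫ y in closedBall 0 1, u (x + R • y) := integral_nonneg fun y => hu0 _
  have hupper : ∫ y, u (x + R • y) * negLapPow k (radialWeight N) y ≤
      C * ∫ y in closedBall 0 1, u (x + R • y) := by
    rw [← setIntegral_eq_integral_of_forall_compl_eq_zero (s := closedBall 0 1)
      fun y hy => by rw [hsupp y hy, mul_zero], ← integral_const_mul]
    refine setIntegral_mono_on ?_ (huRint.const_mul C) measurableSet_closedBall fun y hy => ?_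
    · exact (huR.continuous.mul hg).continuousOn.integrableOn_compact (isCompact_closedBall _ _)
    · rw [mul_comm C]
      exact mul_le_mul_of_nonneg_left ((le_abs_self _).trans (hC y hy)) (hu0 _)
  have hmean := mul_integral_radialWeight_le hw hsub x hR0.le
  have hgreen : R ^ (2 * k) * ∫ y, negLapPow k u (x + R • y) * radialWeight N y =
      ∫ y, u (x + R • y) * negLapPow k (radialWeight N) y := by
    rw [← integral_negLapPow_mul huR (contDiff_radialWeight N) (hasCompactSupport_radialWeight N),
      negLapPow_comp_add_smul huk, ← integral_const_mul]
    simp only [mul_assoc]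
  rcases le_total (∫ y, negLapPow k u (x + R • y) * radialWeight N y) 0 with hneg | hnn
  · exact hmean.trans (hneg.trans (mul_nonneg hC0 hJ))
  · exact hmean.trans ((le_mul_of_one_le_left hnn hRk).trans (hgreen.le.trans hupper))

theorem stmt_1 (N m : ℕ) (hm : 1 ≤ m) (hN : 2 * m < N)
    (Ψ : ℝ → ℝ) (hK : CondK N Ψ)
    (p q : ℝ) (hp : 1 ≤ p) (hq : 0 < q)
    (u : EuclideanSpace ℝ (Fin N) → ℝ)
    (hreg : ContDiff ℝ (2 * m) u)
    (hpos : ∀ x, 0 ≤ u x)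
    (hint : IntegrableOn (fun y : EuclideanSpace ℝ (Fin N) => u y ^ p * Ψ (‖y‖ / 2))
      {y : EuclideanSpace ℝ (Fin N) | 1 < ‖y‖})
    (hineq : ∀ x : EuclideanSpace ℝ (Fin N),
      (∫ y : EuclideanSpace ℝ (Fin N), u y ^ p * Ψ ‖y - x‖) * u x ^ q ≤ -(negLapPow m u x)) :
    ∀ x, u x = 0 := by
  have hu : ContDiff ℝ (2 * m : ℕ) u := by exact_mod_cast hreg
  have hup : Continuous fun y => u y ^ p :=
    hu.continuous.rpow_const fun _ => Or.inr (zero_le_one.trans hp)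
  have havg (x : EuclideanSpace ℝ (Fin N)) :
      Tendsto (fun R : ℝ => ∫ y in closedBall 0 1, u (x + R • y)) atTop (nhds 0) := by
    have hc (R : ℝ) : Continuous fun y : EuclideanSpace ℝ (Fin N) => x + R • y := by fun_prop
    refine tendsto_setIntegral_zero_of_rpow measurableSet_closedBall
      measure_closedBall_lt_top.ne hp (fun R y => hpos _) (fun R => ?_) (fun R => ?_)
      (hK.tendsto_setIntegral_closedBall_zero (by omega) hup
        (fun y => Real.rpow_nonneg (hpos y) p) hint x)
    · exact (hu.continuous.comp (hc R)).continuousOn.integrableOn_compact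
        (isCompact_closedBall _ _)
    · exact (hup.comp (hc R)).continuousOn.integrableOn_compact (isCompact_closedBall _ _)
  have hbase (x : EuclideanSpace ℝ (Fin N)) : negLapPow m u x ≤ 0 := by
    have : Nonempty (Fin N) := ⟨⟨0, by omega⟩⟩
    have hI : 0 ≤ ∫ y : EuclideanSpace ℝ (Fin N), u y ^ p * Ψ ‖y - x‖ := by
      refine integral_nonneg_of_ae ?_
      filter_upwards [Measure.ae_ne volume x] with y hy
      exact mul_nonneg (Real.rpow_nonneg (hpos y) p)
        (hK.pos _ (norm_pos_iff.2 (sub_ne_zero.2 hy))).le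
    have h := (mul_nonneg hI (Real.rpow_nonneg (hpos x) q)).trans (hineq x)
    linarith
  have hall : ∀ x, negLapPow 0 u x ≤ 0 :=
    Nat.decreasingInduction (n := m) (motive := fun k _ => ∀ x, negLapPow k u x ≤ 0)
      (fun k hk ih => negLapPow_nonpos_of_succ (hu.of_le (by norm_cast; omega)) hpos havg ih)
      hbase (Nat.zero_le m)
  exact fun x => le_antisymm (hall x) (hpos x)
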